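/- arXiv:2502.06013 — 2 statements merged into one kernel-verified Lean document; each statement's English description precedes it below -/
import Mathlib

section
/- Every bipartite simple graph G on n ≥ 3 vertices is expelling. -/
open scoped Classical

/-- The state space `Ξₙ` for a graph on vertex set `V` with `n = |V|`: a state `(v, i, ε)`
consists of a bijection `v` from the vertices to the positions `ℤ/n` (the replica of vertex
`a` sits at position `v a`; positions increase clockwise), the index `i : ℤ/n`, and the
orientation `ε ∈ {±1}` encoded as a `Bool` (`true` = `+1`, `false` = `-1`). -/
abbrev Xi (V : Type*) [Fintype V] : Type _ :=
  (V ≃ ZMod (Fintype.card V)) × ZMod (Fintype.card V) × Bool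

/-- The orientation `ε` as an element of `ℤ/n`. -/
def epsZ (n : ℕ) (e : Bool) : ZMod n := if e then 1 else -1

/-- Refractive toric promotion `Θ_G`:
`Θ_G (v,i,ε) = (s̄ᵢ v, i+ε, ε)` if `{v⁻¹(i), v⁻¹(i+1)}` is not an edge of `G`, and
`Θ_G (v,i,ε) = (s̄ᵢ v, i−ε, −ε)` if it is an edge of `G`.  Here `s̄ᵢ v` swaps the replicas
sitting at positions `i` and `i+1`. -/
noncomputable def theta {V : Type*} [Fintype V] (G : SimpleGraph V) (D : Xi V) : Xi V :=
  if G.Adj (D.1.symm D.2.1) (D.1.symm (D.2.1 + 1)) then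
    (D.1.trans (Equiv.swap D.2.1 (D.2.1 + 1)), D.2.1 - epsZ _ D.2.2, !D.2.2)
  else
    (D.1.trans (Equiv.swap D.2.1 (D.2.1 + 1)), D.2.1 + epsZ _ D.2.2, D.2.2)

/-- The net number of clockwise steps that the replica of vertex `a` makes during one
application of `Θ_G` to the state `D`: each application swaps the replicas at positions
`i` and `i+1`, moving the former one step clockwise and the latter one step
counterclockwise. -/
def disp {V : Type*} [Fintype V] (D : Xi V) (a : V) : ℤ :=
  if D.1 a = D.2.1 then 1 else if D.1 a = D.2.1 + 1 then -1 else 0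

/-- `n` times the winding number `w_O(a)` of vertex `a` with respect to the orbit `O` of the
state `D` under `Θ_G`: the net number of clockwise steps made by the replica of `a` during
`P` consecutive applications of `Θ_G` starting from `D`, where `P` is the size of the orbit
(i.e. the minimal period of `D`).  The winding number itself is `windSum G D a / n`; in
particular `w_O(a) = 0` iff `windSum G D a = 0`, and `w_O(a) = w_O(b)` iff
`windSum G D a = windSum G D b`. -/
noncomputable def windSum {V : Type*} [Fintype V] (G : SimpleGraph V) (D : Xi V) (a : V) : ℤ :=
  ∑ k ∈ Finset.range (Function.minimalPeriod (theta G) D), disp ((theta G)^[k] D) a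

/-- The winding vector of the orbit of `D` under `Θ_G` is zero. -/
def WindingVectorZero {V : Type*} [Fintype V] (G : SimpleGraph V) (D : Xi V) : Prop :=
  ∀ a : V, windSum G D a = 0

/-- `G` is ensnaring if every orbit of `Θ_G` has winding vector `0`. -/
def Ensnaring {V : Type*} [Fintype V] (G : SimpleGraph V) : Prop :=
  ∀ D : Xi V, WindingVectorZero G D

/-- `G` is expelling if no orbit of `Θ_G` has winding vector `0`. -/
def Expelling {V : Type*} [Fintype V] (G : SimpleGraph V) : Prop :=
  ∀ D : Xi V, ¬ WindingVectorZero G D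

section Helpers

variable {V : Type*} [Fintype V]

lemma theta_one (G : SimpleGraph V) (D : Xi V) :
    (theta G D).1 = D.1.trans (Equiv.swap D.2.1 (D.2.1 + 1)) := by
  unfold theta; split_ifs <;> rfl

lemma theta_idx (G : SimpleGraph V) (D : Xi V) :
    (theta G D).2.1 - epsZ _ (theta G D).2.2 = D.2.1 := by
  unfold theta; split_ifs <;> rcases D with ⟨v, i, _ | _⟩ <;> simp [epsZ]

lemma theta_eps (G : SimpleGraph V) (D : Xi V) :
    (theta G D).2.2 = if G.Adj (D.1.symm D.2.1) (D.1.symm (D.2.1 + 1)) then !D.2.2 else D.2.2 := by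
  unfold theta; split_ifs <;> rfl

lemma theta_inj (G : SimpleGraph V) : Function.Injective (theta G) := by
  intro D E h
  have hi : D.2.1 = E.2.1 := by rw [← theta_idx G D, ← theta_idx G E, h]
  have hv : D.1 = E.1 := by
    have h1 := theta_one G D
    rw [h, theta_one, hi] at h1
    ext a
    have := DFunLike.congr_fun h1 a
    simpa using this.symm
  have he : D.2.2 = E.2.2 := by
    have h1 := theta_eps G D
    rw [h, theta_eps, hi, hv] at h1
    split_ifs at h1 <;> simpa using h1.symm
  exact Prod.ext hv (Prod.ext hi he)

/-- the carried token -/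
def carr (D : Xi V) : V := if D.2.2 then D.1.symm D.2.1 else D.1.symm (D.2.1 + 1)

lemma carr_step (G : SimpleGraph V) (D : Xi V)
    (h : ¬ G.Adj (D.1.symm D.2.1) (D.1.symm (D.2.1 + 1))) :
    carr (theta G D) = carr D ∧ (theta G D).2.2 = D.2.2 := by
  unfold theta
  rw [if_neg h]
  rcases D with ⟨v, i, _ | _⟩ <;> simp [carr, epsZ]

lemma carr_step_adj (G : SimpleGraph V) (D : Xi V)
    (h : G.Adj (D.1.symm D.2.1) (D.1.symm (D.2.1 + 1))) :
    G.Adj (carr D) (carr (theta G D)) ∧ (theta G D).2.2 = !D.2.2 := by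
  unfold theta
  rw [if_pos h]
  rcases D with ⟨v, i, _ | _⟩
  · simpa [carr, epsZ] using h.symm
  · simpa [carr, epsZ] using h

lemma inv_step (G : SimpleGraph V) (C : V → Bool) (hC : ∀ a b, G.Adj a b → C a ≠ C b)
    (D : Xi V) : (C (carr (theta G D)) ^^ (theta G D).2.2) = (C (carr D) ^^ D.2.2) := by
  by_cases h : G.Adj (D.1.symm D.2.1) (D.1.symm (D.2.1 + 1))
  · obtain ⟨h1, h2⟩ := carr_step_adj G D h
    have := hC _ _ h1
    rw [h2]
    revert this
    generalize C (carr D) = x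
    generalize C (carr (theta G D)) = y
    generalize D.2.2 = z
    revert x y z; decide
  · obtain ⟨h1, h2⟩ := carr_step G D h
    rw [h1, h2]

lemma inv_iter (G : SimpleGraph V) (C : V → Bool) (hC : ∀ a b, G.Adj a b → C a ≠ C b)
    (D : Xi V) (k : ℕ) :
    (C (carr ((theta G)^[k] D)) ^^ ((theta G)^[k] D).2.2) = (C (carr D) ^^ D.2.2) := by
  induction k with
  | zero => rfl
  | succ k ih => rw [Function.iterate_succ_apply', inv_step G C hC, ih]

lemma sum_disp [Nontrivial (ZMod (Fintype.card V))] (D : Xi V) (f : V → ℤ) :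
    ∑ a, f a * disp D a = f (D.1.symm D.2.1) - f (D.1.symm (D.2.1 + 1)) := by
  have : ∀ a, f a * disp D a = (if a = D.1.symm D.2.1 then f a else 0)
      - (if a = D.1.symm (D.2.1 + 1) then f a else 0) := by
    intro a
    simp only [disp, Equiv.eq_symm_apply]
    by_cases h1 : D.1 a = D.2.1
    · simp [h1]
    · by_cases h2 : D.1 a = D.2.1 + 1 <;> simp [h1, h2]
  simp only [this, Finset.sum_sub_distrib]
  simp

lemma disp_carr [Nontrivial (ZMod (Fintype.card V))] (D : Xi V) :
    disp D (carr D) = if D.2.2 then 1 else -1 := by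
  rcases D with ⟨v, i, _ | _⟩ <;> simp [disp, carr]

theorem expelling_aux [Nontrivial (ZMod (Fintype.card V))] (G : SimpleGraph V)
    (C : V → Bool) (hC : ∀ a b, G.Adj a b → C a ≠ C b) : Expelling G := by
  intro D hD
  have : NeZero (Fintype.card V) := ⟨by
    haveI : Nonempty V := ⟨D.1.symm 0⟩
    exact Fintype.card_ne_zero⟩
  have hP : 0 < Function.minimalPeriod (theta G) D :=
    Function.minimalPeriod_pos_of_mem_periodicPts ((theta_inj G).mem_periodicPts D)
  set P := Function.minimalPeriod (theta G) D with hPdef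
  set q := (C (carr D) ^^ D.2.2) with hq
  let f : V → ℤ := fun a => if (C a ^^ true) = q then 1 else 0
  let S : ℕ → ℤ := fun k => ∑ a, f a * disp ((theta G)^[k] D) a
  have hsum : ∑ k ∈ Finset.range P, S k = 0 := by
    simp only [S]
    rw [Finset.sum_comm]
    apply Finset.sum_eq_zero
    intro a _
    rw [← Finset.mul_sum]
    have := hD a
    unfold windSum at this
    rw [← hPdef] at this
    rw [this, mul_zero]
  have key : ∀ E : Xi V, (C (carr E) ^^ E.2.2) = q →
      0 ≤ f (E.1.symm E.2.1) - f (E.1.symm (E.2.1 + 1)) ∧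
      (G.Adj (E.1.symm E.2.1) (E.1.symm (E.2.1 + 1)) →
        0 < f (E.1.symm E.2.1) - f (E.1.symm (E.2.1 + 1))) := by
    intro E hE
    have h2 := hC (E.1.symm E.2.1) (E.1.symm (E.2.1 + 1))
    simp only [f, ← hE]
    unfold carr
    clear hsum hE
    generalize G.Adj (E.1.symm E.2.1) (E.1.symm (E.2.1 + 1)) = A at *
    generalize hx : E.1.symm E.2.1 = a at *
    generalize hy : E.1.symm (E.2.1 + 1) = b at *
    generalize E.2.2 = e
    rcases e <;> cases ha : C a <;> cases hb : C b <;> simp_all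
  have hS0 : ∀ k ∈ Finset.range P, S k = 0 := by
    refine (Finset.sum_eq_zero_iff_of_nonneg ?_).1 hsum
    intro k _
    simp only [S]
    rw [sum_disp]
    exact (key _ (inv_iter G C hC D k)).1
  have hno : ∀ k < P, ¬ G.Adj (((theta G)^[k] D).1.symm ((theta G)^[k] D).2.1)
      (((theta G)^[k] D).1.symm (((theta G)^[k] D).2.1 + 1)) := by
    intro k hk hadj
    have h1 := (key _ (inv_iter G C hC D k)).2 hadj
    rw [← sum_disp] at h1
    exact h1.ne' (hS0 k (Finset.mem_range.2 hk))
  have hconst : ∀ k ≤ P, carr ((theta G)^[k] D) = carr D ∧ ((theta G)^[k] D).2.2 = D.2.2 := by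
    intro k
    induction k with
    | zero => intro _; exact ⟨rfl, rfl⟩
    | succ k ih =>
      intro hk
      obtain ⟨h1, h2⟩ := ih (by omega)
      obtain ⟨h3, h4⟩ := carr_step G _ (hno k (by omega))
      rw [Function.iterate_succ_apply']
      exact ⟨h3.trans h1, h4.trans h2⟩
  have hw := hD (carr D)
  unfold windSum at hw
  rw [← hPdef] at hw
  have : ∀ k ∈ Finset.range P, disp ((theta G)^[k] D) (carr D) = if D.2.2 then 1 else -1 := by
    intro k hk
    obtain ⟨h1, h2⟩ := hconst k (Finset.mem_range.1 hk).le
    rw [← h2, ← disp_carr, h1]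
  rw [Finset.sum_congr rfl this, Finset.sum_const, Finset.card_range] at hw
  split_ifs at hw <;> simp at hw <;> omega

end Helpers

/-- Every bipartite simple graph on `n ≥ 3` vertices is expelling. -/
theorem stmt_1 (n : ℕ) (hn : 3 ≤ n) (G : SimpleGraph (Fin n)) (hbip : G.Colorable 2) :
    Expelling G := by
  obtain ⟨c⟩ := hbip
  haveI : Fact (1 < Fintype.card (Fin n)) := ⟨by simp; omega⟩
  haveI : Nontrivial (ZMod (Fintype.card (Fin n))) := ZMod.nontrivial _
  refine expelling_aux G (fun a => decide (c a = 0)) ?_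
  intro a b hab
  have := c.valid hab
  revert this
  generalize c a = x
  generalize c b = y
  revert x y
  simp only [Fin.forall_fin_two]
  simp
end

section
/- Every expelling simple graph G on n ≥ 3 vertices is bipartite; equivalently, if G is not bipartite (i.e., G contains an odd cycle), then some orbit of Θ_G has winding vector 0. -/
open scoped Classical

theorem walk_part {V : Type*} (G : SimpleGraph V) (h : ¬ G.Colorable 2) :
    ∃ (l : ℕ) (f : ℕ → V), 3 ≤ l ∧ l % 2 = 1 ∧ (∀ j, f (j + l) = f j) ∧
      (∀ j, G.Adj (f j) (f (j+1))) ∧ (∀ i j, f i = f j → i % l = j % l) ∧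
      (∀ i j, G.Adj (f i) (f j) → j % l = (i+1) % l ∨ i % l = (j+1) % l) := by
  have hex : ∃ l : ℕ, l % 2 = 1 ∧ ∃ (u : V) (p : G.Walk u u), p.length = l := by
    rw [SimpleGraph.two_colorable_iff_forall_loop_even] at h
    push Not at h
    obtain ⟨u, p, hp⟩ := h
    exact ⟨p.length, Nat.odd_iff.1 (by simpa using hp), u, p, rfl⟩
  obtain ⟨hodd, u, p, hp⟩ := Nat.find_spec hex
  have hmin : ∀ (w : V) (q : G.Walk w w), q.length % 2 = 1 → Nat.find hex ≤ q.length :=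
    fun w q hq => Nat.find_min' hex ⟨hq, w, q, rfl⟩
  set l := Nat.find hex with hl
  clear_value l
  have h3 : 3 ≤ l := by
    by_contra hlt
    have : l = 1 := by omega
    rw [this] at hp
    exact G.loopless.irrefl u (SimpleGraph.Walk.adj_of_length_eq_one hp)
  have seg : ∀ i j, i ≤ j → j ≤ l → ∃ q : G.Walk (p.getVert i) (p.getVert j), q.length = j - i := by
    intro i j hij hj
    have e : (p.drop i).getVert (j - i) = p.getVert j := by
      rw [SimpleGraph.Walk.drop_getVert]; congr 1; omega
    refine ⟨((p.drop i).take (j - i)).copy rfl e, ?_⟩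
    rw [SimpleGraph.Walk.length_copy, SimpleGraph.Walk.take_length, SimpleGraph.Walk.drop_length]
    omega
  have seg' : ∀ i j, i ≤ j → j ≤ l →
      ∃ q : G.Walk (p.getVert j) (p.getVert i), q.length = l - (j - i) := by
    intro i j hij hj
    refine ⟨(p.drop j).append (p.take i), ?_⟩
    rw [SimpleGraph.Walk.length_append, SimpleGraph.Walk.take_length, SimpleGraph.Walk.drop_length]
    omega
  have inj0 : ∀ i j, i < j → j < l → p.getVert i ≠ p.getVert j := by
    intro i j hij hj he
    obtain ⟨q, hq⟩ := seg i j hij.le hj.le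
    obtain ⟨q', hq'⟩ := seg' i j hij.le hj.le
    have a1 := hmin _ (q.copy he rfl)
    have a2 := hmin _ (q'.copy rfl he)
    rw [SimpleGraph.Walk.length_copy] at a1 a2
    omega
  have ch0 : ∀ i j, i < j → j < l → G.Adj (p.getVert i) (p.getVert j) →
      j = i + 1 ∨ (i = 0 ∧ j + 1 = l) := by
    intro i j hij hj he
    obtain ⟨q, hq⟩ := seg i j hij.le hj.le
    obtain ⟨q', hq'⟩ := seg' i j hij.le hj.le
    have a1 := hmin _ (SimpleGraph.Walk.cons he.symm q)
    have a2 := hmin _ (SimpleGraph.Walk.cons he q')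
    rw [SimpleGraph.Walk.length_cons] at a1 a2
    omega
  have hz : p.getVert l = p.getVert 0 := by
    rw [← hp, SimpleGraph.Walk.getVert_length, SimpleGraph.Walk.getVert_zero]
  have hm : ∀ j, j % l < l := fun j => Nat.mod_lt _ (by omega)
  have hs : ∀ j, (j + 1) % l = if j % l + 1 = l then 0 else j % l + 1 := by
    intro j
    rw [Nat.add_mod, Nat.mod_eq_of_lt (show 1 < l by omega)]
    split_ifs with hc
    · rw [hc, Nat.mod_self]
    · exact Nat.mod_eq_of_lt (by have := hm j; omega)
  refine ⟨l, fun j => p.getVert (j % l), h3, hodd, ?_, ?_, ?_, ?_⟩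
  · intro j; simp
  · intro j
    have := p.adj_getVert_succ (i := j % l) (by rw [hp]; exact hm j)
    simp only [hs]
    split_ifs with hc
    · rw [hc, hz] at this; exact this
    · exact this
  · intro i j he
    have := hm i; have := hm j
    rcases lt_trichotomy (i % l) (j % l) with hlt | hlt | hlt
    · exact (inj0 _ _ hlt (hm j) he).elim
    · exact hlt
    · exact (inj0 _ _ hlt (hm i) he.symm).elim
  · intro i j he
    have := hm i; have := hm j
    rcases lt_trichotomy (i % l) (j % l) with hlt | hlt | hlt
    · have := ch0 _ _ hlt (hm j) he
      rw [hs, hs]; split_ifs <;> omega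
    · simp only [hlt] at he
      exact (G.loopless.irrefl _ he).elim
    · have := ch0 _ _ hlt (hm i) he.symm
      rw [hs, hs]; split_ifs <;> omega

section dyn
variable {V : Type*} [Fintype V]

def pos (v : V ≃ ZMod (Fintype.card V)) (a : V) : ℕ := (v a).val

structure RInv (l : ℕ) (f : ℕ → V) (k : ℕ) (D : Xi V) : Prop where
  car : (k % 2 = 0 ∧ D.2.2 = true ∧ D.1 (f k) = D.2.1) ∨
        (k % 2 = 1 ∧ D.2.2 = false ∧ D.1 (f k) = D.2.1 + 1)
  ord : ∀ j, k ≤ j → j < k + l → (j % 2 = 0 → pos D.1 (f j) < pos D.1 (f (j+1))) ∧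
        (j % 2 = 1 → pos D.1 (f (j+1)) < pos D.1 (f j))
  blk : ∀ a, pos D.1 a < l ↔ ∃ j, f j = a

theorem pos_inj (v : V ≃ ZMod (Fintype.card V)) [NeZero (Fintype.card V)] {a b : V}
    (h : pos v a = pos v b) : a = b :=
  v.injective (ZMod.val_injective _ h)

theorem pos_swap [NeZero (Fintype.card V)] (v : V ≃ ZMod (Fintype.card V)) (i : ZMod (Fintype.card V))
    (h : i.val + 1 < Fintype.card V) :
    pos v (v.symm i) = i.val ∧ pos v (v.symm (i+1)) = i.val + 1 ∧
    (∀ a, pos (v.trans (Equiv.swap i (i+1))) a =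
      if a = v.symm i then i.val + 1 else if a = v.symm (i+1) then i.val else pos v a) := by
  have h1 : (i+1).val = i.val + 1 := by
    have : Fact (1 < Fintype.card V) := ⟨by omega⟩
    rw [ZMod.val_add_of_lt] <;> rw [ZMod.val_one]
    exact h
  refine ⟨by simp [pos], by simp [pos, h1], fun a => ?_⟩
  simp only [pos, Equiv.trans_apply, Equiv.swap_apply_def, Equiv.eq_symm_apply]
  split_ifs <;> simp [h1]

theorem disp_eq [NeZero (Fintype.card V)] (G : SimpleGraph V) (D : Xi V) (a : V)
    (h : D.2.1.val + 1 < Fintype.card V) :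
    disp D a = (pos (theta G D).1 a : ℤ) - pos D.1 a := by
  obtain ⟨h1, h2, h3⟩ := pos_swap D.1 D.2.1 h
  have : (theta G D).1 = D.1.trans (Equiv.swap D.2.1 (D.2.1+1)) := by
    unfold theta; split_ifs <;> rfl
  rw [this, h3]
  simp only [disp, ← Equiv.eq_symm_apply]
  split_ifs with ha hb
  · subst ha; rw [h1]; push_cast; ring
  · subst hb; rw [h2]; push_cast; ring
  · ring

theorem wind_zero [NeZero (Fintype.card V)] (G : SimpleGraph V) (D : Xi V)
    (h : ∀ k, ((theta G)^[k] D).2.1.val + 1 < Fintype.card V) : WindingVectorZero G D := by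
  intro a
  have : ∀ m, ∑ k ∈ Finset.range m, disp ((theta G)^[k] D) a =
      (pos ((theta G)^[m] D).1 a : ℤ) - pos D.1 a := by
    intro m
    induction m with
    | zero => simp
    | succ m ih =>
      rw [Finset.sum_range_succ, ih, disp_eq G _ a (h m), Function.iterate_succ_apply']; ring
  rw [windSum, this, Function.isPeriodicPt_minimalPeriod (theta G) D]; simp

theorem inv_lt [NeZero (Fintype.card V)] (l : ℕ) (f : ℕ → V) (h3 : 3 ≤ l)
    (hl : l ≤ Fintype.card V) {k : ℕ} {D : Xi V} (h : RInv l f k D) : D.2.1.val + 1 < l := by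
  have hb1 := (h.blk (f k)).2 ⟨k, rfl⟩
  have hb2 := (h.blk (f (k+1))).2 ⟨_, rfl⟩
  have ho := h.ord k le_rfl (by omega)
  rcases h.car with ⟨hk, -, hc⟩ | ⟨hk, -, hc⟩
  · have := ho.1 hk
    simp only [pos, hc] at *
    omega
  · have := ho.2 hk
    have e : D.2.1 = D.1 (f k) - 1 := by rw [hc]; ring
    have hf : Fact (1 < Fintype.card V) := ⟨by omega⟩
    have : D.2.1.val = (D.1 (f k)).val - 1 := by
      rw [e, ZMod.val_sub, ZMod.val_one]
      rw [ZMod.val_one]; simp only [pos] at *; omega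
    simp only [pos] at *
    omega

theorem inv_step_s2 [NeZero (Fintype.card V)] (G : SimpleGraph V) (l : ℕ) (f : ℕ → V) (h3 : 3 ≤ l)
    (hodd : l % 2 = 1) (hl : l ≤ Fintype.card V)
    (hper : ∀ j, f (j + l) = f j) (hadj : ∀ j, G.Adj (f j) (f (j+1)))
    (hinj : ∀ i j, f i = f j → i % l = j % l)
    (hch : ∀ i j, G.Adj (f i) (f j) → j % l = (i+1) % l ∨ i % l = (j+1) % l)
    (k : ℕ) (D : Xi V) (h : RInv l f k D) : ∃ k', RInv l f k' (theta G D) := by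
  have hlt := inv_lt l f h3 hl h
  obtain ⟨v, i, e⟩ := D
  obtain ⟨hcar, hord, hblk⟩ := h
  simp only at hcar hord hblk hlt
  obtain ⟨hx, hy, hp⟩ := pos_swap v i (by omega)
  have hfmod : ∀ a b, a % l = b % l → f a = f b := by
    have : ∀ a, f a = f (a % l) := fun a => (Function.Periodic.map_mod_nat hper a).symm
    intro a b hab; rw [this a, this b, hab]
  have hne : ∀ a d, 0 < d → d < l → f (a + d) ≠ f a := by
    intro a d hd hdl he
    have h1 : (a + d) ≡ a + 0 [MOD l] := hinj _ _ he
    have h2 := Nat.ModEq.add_left_cancel' a h1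
    have h4 : d % l = 0 % l := h2
    rw [Nat.mod_eq_of_lt hdl, Nat.zero_mod] at h4
    omega
  -- neighbours on the cycle
  have hnb : ∀ m, G.Adj (f k) (f m) → f m = f (k+1) ∨ f m = f (k + l - 1) := by
    intro m hm
    rcases hch _ _ hm with h1 | h1
    · exact Or.inl (hfmod _ _ h1)
    · right
      apply hfmod
      have h2 : (k + l - 1) + 1 ≡ m + 1 [MOD l] := by
        have : k + l - 1 + 1 = k + l := by omega
        rw [this]
        show (k + l) % l = _
        rw [Nat.add_mod_right]; exact h1
      exact (Nat.ModEq.add_right_cancel' 1 h2).symm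
  set x := v.symm i with hxd
  set y := v.symm (i+1) with hyd
  have hxy : x ≠ y := by intro hh; rw [hh] at hx; omega
  set w := v.trans (Equiv.swap i (i+1)) with hw
  have hwx : w x = i + 1 := by simp [hw, hxd]
  have hwy : w y = i := by simp [hw, hyd]
  have hblk' : ∀ a, pos w a < l ↔ ∃ j, f j = a := by
    intro a
    rw [← hblk, hp]
    split_ifs with h1 h2
    · subst h1; omega
    · subst h2; omega
    · rfl
  have hpres : ∀ a b, ¬ (a = x ∧ b = y) → pos v a < pos v b → pos w a < pos w b := by
    intro a b hab hlt
    have ia : ∀ c, pos v c = i.val → c = x := fun c hc => pos_inj v (by omega)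
    have ib : ∀ c, pos v c = i.val + 1 → c = y := fun c hc => pos_inj v (by omega)
    have ha1 := ia a; have ha2 := ib a; have hb1 := ia b; have hb2 := ib b
    rw [hp, hp]
    split_ifs with h1 h2 h4 h5 h6 h7 h8 h9 <;> grind
  have hbx : ∃ j, f j = x := (hblk x).1 (by omega)
  have hby : ∃ j, f j = y := (hblk y).1 (by omega)
  have hok := hord k le_rfl (by omega)
  have hok' := hord (k + l - 1) (by omega) (by omega)
  have hkl : k + l - 1 + 1 = k + l := by omega
  rw [hkl, hper] at hok'
  by_cases hA : G.Adj x y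
  · have hth : theta G (v, i, e) = (w, i - epsZ _ e, !e) := by
      unfold theta; rw [if_pos hA]
    rw [hth]
    refine ⟨k + 1, ?_, ?_, hblk'⟩
    · rcases hcar with ⟨hk, he, hc⟩ | ⟨hk, he, hc⟩
      · right
        have hfx : f k = x := by rw [hxd, ← hc]; simp
        obtain ⟨m, hm⟩ := hby
        have hfy : f (k+1) = y := by
          rw [← hfx, ← hm] at hA
          rcases hnb m hA with h1 | h1
          · rw [← h1, hm]
          · have := hok'.1 (by omega)
            rw [← h1, hm, hfx] at this; omega
        refine ⟨by omega, by simp [he], ?_⟩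
        simp [hfy, hwy, he, epsZ]
      · left
        have hfy : f k = y := by rw [hyd, ← hc]; simp
        obtain ⟨m, hm⟩ := hbx
        have hfx : f (k+1) = x := by
          rw [← hfy, ← hm] at hA
          rcases hnb m hA.symm with h1 | h1
          · rw [← h1, hm]
          · have := hok'.2 (by omega)
            rw [← h1, hm, hfy] at this; omega
        refine ⟨by omega, by simp [he], ?_⟩
        simp [hfx, hwx, he, epsZ]
    · have hset : (k % 2 = 0 ∧ f k = x ∧ f (k+1) = y) ∨ (k % 2 = 1 ∧ f k = y ∧ f (k+1) = x) := by
        rcases hcar with ⟨hk, he, hc⟩ | ⟨hk, he, hc⟩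
        · left
          have hfx : f k = x := by rw [hxd, ← hc]; simp
          obtain ⟨m, hm⟩ := hby
          refine ⟨hk, hfx, ?_⟩
          rw [← hfx, ← hm] at hA
          rcases hnb m hA with h1 | h1
          · rw [← h1, hm]
          · have := hok'.1 (by omega)
            rw [← h1, hm, hfx] at this; omega
        · right
          have hfy : f k = y := by rw [hyd, ← hc]; simp
          obtain ⟨m, hm⟩ := hbx
          refine ⟨hk, hfy, ?_⟩
          rw [← hfy, ← hm] at hA
          rcases hnb m hA.symm with h1 | h1
          · rw [← h1, hm]
          · have := hok'.2 (by omega)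
            rw [← h1, hm, hfy] at this; omega
      intro j hj1 hj2
      rcases Nat.lt_or_ge j (k + l) with hj | hj
      · have n1 : f j ≠ f k := by
          have := hne k (j - k) (by omega) (by omega)
          rwa [show k + (j - k) = j by omega] at this
        have n2 : f (j+1) = f k → f j ≠ f (k+1) := by
          intro h1 h2
          rcases Nat.lt_or_ge (k+1) j with h5 | h5
          · have := hne (k+1) (j - (k+1)) (by omega) (by omega)
            rw [show k + 1 + (j - (k+1)) = j by omega] at this
            exact this h2
          · have := hne k (j + 1 - k) (by omega) (by omega)
            rw [show k + (j + 1 - k) = j + 1 by omega] at this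
            exact this h1
        have ho := hord j (by omega) hj
        refine ⟨fun hh => hpres _ _ ?_ (ho.1 hh), fun hh => hpres _ _ ?_ (ho.2 hh)⟩
        · rintro ⟨r1, r2⟩; rcases hset with ⟨_, s1, s2⟩ | ⟨_, s1, s2⟩ <;> grind
        · rintro ⟨r1, r2⟩; rcases hset with ⟨_, s1, s2⟩ | ⟨_, s1, s2⟩ <;> grind
      · have hj : j = k + l := by omega
        subst hj
        rw [show k + l + 1 = (k + 1) + l by omega, hper, hper]
        have q1 : pos w x = i.val + 1 := by rw [hp]; simp
        have q2 : pos w y = i.val := by rw [hp]; simp [hxy.symm]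
        rcases hset with ⟨s0, s1, s2⟩ | ⟨s0, s1, s2⟩ <;> rw [s1, s2] <;>
          constructor <;> intro _ <;> simp only [q1, q2] <;> omega
  · have hth : theta G (v, i, e) = (w, i + epsZ _ e, e) := by
      unfold theta; rw [if_neg hA]
    rw [hth]
    refine ⟨k, ?_, ?_, hblk'⟩
    · rcases hcar with ⟨hk, he, hc⟩ | ⟨hk, he, hc⟩
      · left
        have hfx : f k = x := by rw [hxd, ← hc]; simp
        refine ⟨hk, he, ?_⟩
        simp [hfx, hwx, he, epsZ]
      · right
        have hfy : f k = y := by rw [hyd, ← hc]; simp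
        refine ⟨hk, he, ?_⟩
        simp [hfy, hwy, he, epsZ]
    · intro j hj1 hj2
      have ho := hord j hj1 hj2
      refine ⟨fun hh => hpres _ _ ?_ (ho.1 hh), fun hh => hpres _ _ ?_ (ho.2 hh)⟩
      · rintro ⟨r1, r2⟩; exact hA (r1 ▸ r2 ▸ hadj j)
      · rintro ⟨r1, r2⟩; exact hA (r1 ▸ r2 ▸ (hadj j).symm)

theorem inv_init [NeZero (Fintype.card V)] (l : ℕ) (f : ℕ → V) (h3 : 3 ≤ l)
    (hodd : l % 2 = 1) (hl : l ≤ Fintype.card V)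
    (hper : ∀ j, f (j + l) = f j) (hinj : ∀ i j, f i = f j → i % l = j % l) :
    ∃ D : Xi V, RInv l f 0 D := by
  obtain ⟨m, rfl⟩ : ∃ m, l = 2 * m + 1 := ⟨l / 2, by omega⟩
  let σ : ℕ → ℕ := fun j => if j % 2 = 0 then m - j / 2 else m + 1 + j / 2
  have σlt : ∀ j, j < 2 * m + 1 → σ j < 2 * m + 1 := by
    intro j hj; simp only [σ]; split_ifs <;> omega
  have σinj : ∀ i j, i < 2 * m + 1 → j < 2 * m + 1 → σ i = σ j → i = j := by
    intro i j hi hj; simp only [σ]; split_ifs <;> omega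
  have σsurj : ∀ q, q < 2 * m + 1 → ∃ j, j < 2 * m + 1 ∧ σ j = q := by
    intro q hq
    by_cases hqm : q ≤ m
    · refine ⟨2 * (m - q), by omega, ?_⟩; simp only [σ]; split_ifs <;> omega
    · refine ⟨2 * (q - m - 1) + 1, by omega, ?_⟩; simp only [σ]; split_ifs <;> omega
  have hmod : ∀ a, f a = f (a % (2 * m + 1)) :=
    fun a => (Function.Periodic.map_mod_nat hper a).symm
  have hfi : Function.Injective (fun j : Fin (2 * m + 1) => f j) := by
    intro a b hab
    have := hinj _ _ hab
    rw [Nat.mod_eq_of_lt a.2, Nat.mod_eq_of_lt b.2] at this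
    exact Fin.ext this
  have hσi : Function.Injective
      (fun j : Fin (2 * m + 1) => ((σ j : ℕ) : ZMod (Fintype.card V))) := by
    intro a b hab
    have := congrArg ZMod.val hab
    have ha := σlt a a.2
    have hb := σlt b b.2
    simp only at this
    rw [ZMod.val_natCast_of_lt (by omega), ZMod.val_natCast_of_lt (by omega)] at this
    exact Fin.ext (σinj _ _ a.2 b.2 this)
  have hv : ∃ v : V ≃ ZMod (Fintype.card V), ∀ j : Fin (2 * m + 1),
      v (f j) = ((σ j : ℕ) : ZMod (Fintype.card V)) := by
    let g : V → ZMod (Fintype.card V) :=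
      Function.extend (fun j : Fin (2 * m + 1) => f j)
        (fun j : Fin (2 * m + 1) => ((σ j : ℕ) : ZMod (Fintype.card V))) 0
    have hg : ∀ j : Fin (2 * m + 1), g (f j) = ((σ j : ℕ) : ZMod (Fintype.card V)) :=
      fun j => hfi.extend_apply _ _ j
    obtain ⟨v, hv⟩ := Finset.exists_equiv_extend_of_card_eq
      (t := (Finset.univ : Finset (ZMod (Fintype.card V))))
      (s := Finset.univ.image (fun j : Fin (2 * m + 1) => f j)) (f := g)
      (by simp [ZMod.card]) (by simp) (by
        intro a ha b hb hab
        simp only [Finset.coe_image, Finset.coe_univ, Set.image_univ, Set.mem_range] at ha hb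
        obtain ⟨a, rfl⟩ := ha
        obtain ⟨b, rfl⟩ := hb
        rw [hg, hg] at hab
        rw [hσi hab])
    refine ⟨v.trans (Equiv.subtypeUnivEquiv (by simp)), fun j => ?_⟩
    rw [← hg j, ← hv (f j) (by simp)]
    rfl
  obtain ⟨v, hv⟩ := hv
  have hpos : ∀ j, j < 2 * m + 1 → pos v (f j) = σ j := by
    intro j hj
    have := hv ⟨j, hj⟩
    simp only at this
    rw [pos, this, ZMod.val_natCast_of_lt]
    have := σlt j hj
    omega
  refine ⟨(v, v (f 0), true), Or.inl ⟨rfl, rfl, rfl⟩, ?_, ?_⟩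
  · intro j _ hj
    simp only
    rw [hpos j (by omega)]
    rcases Nat.lt_or_ge (j + 1) (2 * m + 1) with h | h
    · rw [hpos _ h]
      simp only [σ]; split_ifs <;> omega
    · have hj : j = 2 * m := by omega
      subst hj
      have := hper 0
      rw [Nat.zero_add] at this
      rw [this, hpos 0 (by omega)]
      simp only [σ]; split_ifs <;> omega
  · intro a
    constructor
    · intro ha
      obtain ⟨j, hj, hq⟩ := σsurj _ ha
      exact ⟨j, pos_inj v (by rw [hpos j hj, hq])⟩
    · rintro ⟨j, rfl⟩
      rw [hmod j]
      have := Nat.mod_lt j (show 0 < 2 * m + 1 by omega)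
      show pos v _ < _
      rw [hpos _ this]
      exact σlt _ this

end dyn

/-- Every expelling simple graph on `n ≥ 3` vertices is bipartite;
equivalently, if `G` is not bipartite then some orbit of `Θ_G` has winding vector `0`. -/
theorem stmt_2 (n : ℕ) (hn : 3 ≤ n) (G : SimpleGraph (Fin n)) (hexp : Expelling G) :
    G.Colorable 2 := by
  by_contra hc
  obtain ⟨l, f, h3, hodd, hper, hadj, hinj, hch⟩ := walk_part G hc
  have : NeZero (Fintype.card (Fin n)) := ⟨by rw [Fintype.card_fin]; omega⟩
  have hl : l ≤ Fintype.card (Fin n) := by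
    have hfi : Function.Injective (fun j : Fin l => f j) := by
      intro a b hab
      have := hinj _ _ hab
      rw [Nat.mod_eq_of_lt a.2, Nat.mod_eq_of_lt b.2] at this
      exact Fin.ext this
    simpa using Fintype.card_le_of_injective _ hfi
  obtain ⟨D, hD⟩ := inv_init l f h3 hodd hl hper hinj
  have hall : ∀ k, ∃ k', RInv l f k' ((theta G)^[k] D) := by
    intro k
    induction k with
    | zero => exact ⟨0, hD⟩
    | succ k ih =>
      obtain ⟨k', hk'⟩ := ih
      rw [Function.iterate_succ_apply']
      exact inv_step_s2 G l f h3 hodd hl hper hadj hinj hch k' _ hk'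
  refine hexp D (wind_zero G D fun k => ?_)
  obtain ⟨k', hk'⟩ := hall k
  exact lt_of_lt_of_le (inv_lt l f h3 hl hk') hl
end
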